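/- arXiv:2306.05975 — 4 statements merged into one kernel-verified Lean document; each statement's English description precedes it below -/
import Mathlib

section
/- Let q1, q2 ∈ ℕ and q = min(q1, q2). Given q1+1 distinct nodes {η1^{(i)}}_{i=0}^{q1} ⊂ [−1,1] and q2+1 distinct nodes {η2^{(i)}}_{i=0}^{q2} ⊂ [−1,1), the tensor-product interpolation operator I_q is exact for every bivariate polynomial v of total degree at most q: for all (η1, η2) ∈ [−1,1]², ∑_{α1=0}^{q1} ∑_{α2=0}^{q2} v(χ(η1^{(α1)}, η2^{(α2)})) ℓ1^{(α1)}(η1) ℓ2^{(α2)}(η2) = v(χ(η1, η2)). In particular (I_q v)(ξ) = v(ξ) for all ξ ∈ T̂ \ {(−1,1)}. -/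
noncomputable section

/-- The collapsed coordinate map from the square onto the reference triangle. -/
def chi2 (η : ℝ × ℝ) : ℝ × ℝ := ((1 + η.1) * (1 - η.2) / 2 - 1, η.2)

/-- Lagrange basis function on the nodes `η`. -/
def lagr {n : ℕ} (η : Fin n → ℝ) (i : Fin n) (x : ℝ) : ℝ :=
  ∏ j ∈ Finset.univ.erase i, (x - η j) / (η i - η j)

/-- Evaluation of a bivariate polynomial at a point of `ℝ × ℝ`. -/
def ev2 (v : MvPolynomial (Fin 2) ℝ) (x : ℝ × ℝ) : ℝ := MvPolynomial.eval ![x.1, x.2] v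

/-- The reference triangle `T̂ = {ξ ∈ [−1,1]² : ξ1 + ξ2 ≤ 0}`. -/
def refTri : Set (ℝ × ℝ) :=
  {ξ | ξ.1 ∈ Set.Icc (-1:ℝ) 1 ∧ ξ.2 ∈ Set.Icc (-1:ℝ) 1 ∧ ξ.1 + ξ.2 ≤ 0}

/-- A one-dimensional quadrature rule with nodes `η` and weights `ω` is exact of degree `τ`. -/
def exact1D {n : ℕ} (η ω : Fin n → ℝ) (τ : ℕ) : Prop :=
  ∀ f : Polynomial ℝ, f.natDegree ≤ τ →
    ∑ i, ω i * f.eval (η i) = ∫ x in (-1:ℝ)..1, f.eval x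

/-- Lagrange interpolation reproduces polynomials of degree at most `q` on `q + 1` nodes. -/
theorem sum_eval_mul_lagr {q : ℕ} {η : Fin (q + 1) → ℝ} (hη : Function.Injective η)
    {f : Polynomial ℝ} (hf : f.natDegree ≤ q) (x : ℝ) :
    ∑ i, f.eval (η i) * lagr η i x = f.eval x := by
  have hdeg : f.degree < (Finset.univ : Finset (Fin (q + 1))).card :=
    (Polynomial.degree_le_of_natDegree_le hf).trans_lt (by simpa using q.cast_lt.2 q.lt_succ_self)
  conv_rhs => rw [Lagrange.eq_interpolate hη.injOn hdeg]
  simp [Lagrange.interpolate_apply, Polynomial.eval_finsetSum, Lagrange.basis,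
    Polynomial.eval_prod, Lagrange.basisDivisor, lagr, div_eq_inv_mul]

/-- Lagrange interpolation reproduces a bivariate polynomial restricted to a line. -/
theorem sum_ev2_mul_lagr {q : ℕ} {η : Fin (q + 1) → ℝ} (hη : Function.Injective η)
    {v : MvPolynomial (Fin 2) ℝ} (hv : v.totalDegree ≤ q) (a b c d x : ℝ) :
    ∑ i, ev2 v (a * η i + b, c * η i + d) * lagr η i x = ev2 v (a * x + b, c * x + d) := by
  set L : Fin 2 → Polynomial ℝ := ![.C a * .X + .C b, .C c * .X + .C d] with hL
  have hdeg : (MvPolynomial.aeval L v).natDegree ≤ q := by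
    simpa using MvPolynomial.aeval_natDegree_le v hv L (n := 1) fun i => by
      fin_cases i <;> exact Polynomial.natDegree_linear_le
  have heval (t : ℝ) : (MvPolynomial.aeval L v).eval t = ev2 v (a * t + b, c * t + d) := by
    rw [ev2, ← Polynomial.coe_evalRingHom, MvPolynomial.aeval_def, MvPolynomial.hom_eval₂,
      MvPolynomial.eval, MvPolynomial.coe_eval₂Hom]
    congr 1
    · ext r
      simp
    · ext i
      fin_cases i <;> simp [hL]
  simpa only [heval] using sum_eval_mul_lagr hη hdeg x

theorem tensor_product_interpolation_exact_triangle (q1 q2 : ℕ)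
    (η1 : Fin (q1 + 1) → ℝ) (η2 : Fin (q2 + 1) → ℝ)
    (hinj1 : Function.Injective η1) (hinj2 : Function.Injective η2)
    (hr1 : ∀ i, η1 i ∈ Set.Icc (-1:ℝ) 1) (hr2 : ∀ i, η2 i ∈ Set.Ico (-1:ℝ) 1)
    (v : MvPolynomial (Fin 2) ℝ) (hv : v.totalDegree ≤ min q1 q2)
    (x1 x2 : ℝ) (hx1 : x1 ∈ Set.Icc (-1:ℝ) 1) (hx2 : x2 ∈ Set.Icc (-1:ℝ) 1) :
    ∑ a1 : Fin (q1 + 1), ∑ a2 : Fin (q2 + 1),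
      ev2 v (chi2 (η1 a1, η2 a2)) * lagr η1 a1 x1 * lagr η2 a2 x2
      = ev2 v (chi2 (x1, x2)) := by
  have h2 (s : ℝ) : ∑ i, ev2 v (chi2 (s, η2 i)) * lagr η2 i x2 = ev2 v (chi2 (s, x2)) := by
    convert sum_ev2_mul_lagr hinj2 (hv.trans (min_le_right _ _)) (-(1 + s) / 2) ((1 + s) / 2 - 1)
      1 0 x2 using 4 <;> simp only [chi2] <;> ring_nf
  have h1 : ∑ i, ev2 v (chi2 (η1 i, x2)) * lagr η1 i x1 = ev2 v (chi2 (x1, x2)) := by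
    convert sum_ev2_mul_lagr hinj1 (hv.trans (min_le_left _ _)) ((1 - x2) / 2) ((1 - x2) / 2 - 1)
      0 x2 x1 using 4 <;> simp only [chi2] <;> ring_nf
  rw [← h1]
  refine Finset.sum_congr rfl fun i _ => ?_
  rw [← h2, Finset.sum_mul]
  exact Finset.sum_congr rfl fun j _ => mul_right_comm _ _ _
end
end

section
/- Let q1, q2 ∈ ℕ, q = min(q1, q2), let {η1^{(i)}}_{i=0}^{q1} ⊂ [−1,1] and {η2^{(i)}}_{i=0}^{q2} ⊂ [−1,1) be distinct nodes with Lagrange bases ℓ1^{(i)}, ℓ2^{(i)}, and set ξ^{(α1,α2)} = χ(η1^{(α1)}, η2^{(α2)}). Define matrix entries D^{(1)}_{(α1,α2),(β1,β2)} = (2/(1−η2^{(α2)})) (ℓ1^{(β1)})'(η1^{(α1)}) δ_{α2β2} and D^{(2)}_{(α1,α2),(β1,β2)} = ((1+η1^{(α1)})/(1−η2^{(α2)})) (ℓ1^{(β1)})'(η1^{(α1)}) δ_{α2β2} + δ_{α1β1} (ℓ2^{(β2)})'(η2^{(α2)}). Then for every bivariate polynomial v of total degree at most q, every m ∈ {1,2},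 and every multi-index (α1,α2), ∑_{β1=0}^{q1} ∑_{β2=0}^{q2} D^{(m)}_{(α1,α2),(β1,β2)} v(ξ^{(β1,β2)}) = (∂v/∂ξ_m)(ξ^{(α1,α2)}). -/
noncomputable section

theorem lagr_eq_eval_basis {n : ℕ} (η : Fin n → ℝ) (i : Fin n) (x : ℝ) :
    lagr η i x = (Lagrange.basis Finset.univ η i).eval x := by
  simp only [lagr, Lagrange.basis, Lagrange.basisDivisor, Polynomial.eval_prod,
    Polynomial.eval_mul, Polynomial.eval_C, Polynomial.eval_sub, Polynomial.eval_X]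
  exact Finset.prod_congr rfl fun j _ => by rw [div_eq_inv_mul]

theorem deriv_lagr {n : ℕ} (η : Fin n → ℝ) (i : Fin n) (x : ℝ) :
    deriv (lagr η i) x = (Polynomial.derivative (Lagrange.basis Finset.univ η i)).eval x := by
  rw [funext (lagr_eq_eval_basis η i), Polynomial.deriv]

/-- Differentiating the Lagrange interpolant of a polynomial of degree at most `n` at `n + 1`
distinct nodes is exact. -/
theorem sum_deriv_lagr_mul_eval {n : ℕ} {η : Fin (n + 1) → ℝ} (hη : Function.Injective η)
    {f : Polynomial ℝ} (hf : f.natDegree ≤ n) (x : ℝ) :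
    ∑ i, deriv (lagr η i) x * f.eval (η i) = (Polynomial.derivative f).eval x := by
  have hdeg : f.degree < (Finset.univ : Finset (Fin (n + 1))).card := by
    rw [Finset.card_univ, Fintype.card_fin]
    exact (Polynomial.degree_le_of_natDegree_le hf).trans_lt (by exact_mod_cast n.lt_succ_self)
  conv_rhs => rw [Lagrange.eq_interpolate hη.injOn hdeg, Lagrange.interpolate_apply]
  simp [Polynomial.eval_finsetSum, deriv_lagr, mul_comm]

/-- The chain rule for substituting univariate polynomials into a multivariate polynomial. -/
theorem derivative_aeval_eq_sum_pderiv {R σ : Type*} [CommSemiring R] [Fintype σ]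
    (g : σ → Polynomial R) (v : MvPolynomial σ R) :
    Polynomial.derivative (MvPolynomial.aeval g v) =
      ∑ i, MvPolynomial.aeval g (MvPolynomial.pderiv i v) * Polynomial.derivative (g i) := by
  classical
  induction v using MvPolynomial.induction_on with
  | C a => simp
  | add p q hp hq => simp [hp, hq, add_mul, Finset.sum_add_distrib]
  | mul_X p j hp =>
    simp only [map_mul, MvPolynomial.aeval_X, Polynomial.derivative_mul, hp, Derivation.leibniz,
      MvPolynomial.pderiv_X, smul_eq_mul, map_add, add_mul, Finset.sum_add_distrib]
    rw [add_comm, Finset.sum_mul]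
    congr 1
    · rw [Finset.sum_eq_single j]
      · simp
      · intro i _ hij
        simp [hij.symm]
      · simp
    · exact Finset.sum_congr rfl fun i _ => by ring

theorem eval_aeval_eq_ev2 (p r : Polynomial ℝ) (v : MvPolynomial (Fin 2) ℝ) (x : ℝ) :
    (MvPolynomial.aeval ![p, r] v).eval x = ev2 v (p.eval x, r.eval x) := by
  rw [ev2, ← Polynomial.coe_aeval_eq_eval, MvPolynomial.comp_aeval_apply,
    ← MvPolynomial.coe_aeval_eq_eval, RingHom.coe_coe]
  congr 2
  funext i
  fin_cases i <;> simp

/-- One-dimensional Lagrange differentiation is exact along a line in the plane. -/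
theorem sum_deriv_lagr_mul_ev2 {n : ℕ} {η : Fin (n + 1) → ℝ} (hη : Function.Injective η)
    {v : MvPolynomial (Fin 2) ℝ} (hv : v.totalDegree ≤ n) (a b c d x : ℝ) :
    ∑ i, deriv (lagr η i) x * ev2 v (a * η i + b, c * η i + d) =
      a * ev2 (MvPolynomial.pderiv 0 v) (a * x + b, c * x + d) +
        c * ev2 (MvPolynomial.pderiv 1 v) (a * x + b, c * x + d) := by
  let g : Fin 2 → Polynomial ℝ := ![.C a * .X + .C b, .C c * .X + .C d]
  have hg : ∀ i, (g i).natDegree ≤ 1 := by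
    intro i
    fin_cases i <;> exact Polynomial.natDegree_linear_le
  have heval (w : MvPolynomial (Fin 2) ℝ) (t : ℝ) :
      (MvPolynomial.aeval g w).eval t = ev2 w (a * t + b, c * t + d) := by
    simp [g, eval_aeval_eq_ev2]
  have hdeg : (MvPolynomial.aeval g v).natDegree ≤ n := by
    simpa using MvPolynomial.aeval_natDegree_le v hv g hg
  have key := sum_deriv_lagr_mul_eval hη hdeg x
  simp only [heval, derivative_aeval_eq_sum_pderiv, Fin.sum_univ_two, Polynomial.eval_add,
    Polynomial.eval_mul] at key
  rw [key, mul_comm a (ev2 _ _), mul_comm c (ev2 _ _)]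
  simp [g]

theorem differentiation_matrices_exact_triangle (q1 q2 : ℕ)
    (η1 : Fin (q1 + 1) → ℝ) (η2 : Fin (q2 + 1) → ℝ)
    (hinj1 : Function.Injective η1) (hinj2 : Function.Injective η2)
    (hr1 : ∀ i, η1 i ∈ Set.Icc (-1:ℝ) 1) (hr2 : ∀ i, η2 i ∈ Set.Ico (-1:ℝ) 1)
    (v : MvPolynomial (Fin 2) ℝ) (hv : v.totalDegree ≤ min q1 q2)
    (a1 : Fin (q1 + 1)) (a2 : Fin (q2 + 1)) :
    (∑ b1 : Fin (q1 + 1), ∑ b2 : Fin (q2 + 1),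
        ((2 / (1 - η2 a2)) * deriv (lagr η1 b1) (η1 a1) *
          (if a2 = b2 then (1:ℝ) else 0)) * ev2 v (chi2 (η1 b1, η2 b2))
        = ev2 (MvPolynomial.pderiv 0 v) (chi2 (η1 a1, η2 a2))) ∧
    (∑ b1 : Fin (q1 + 1), ∑ b2 : Fin (q2 + 1),
        (((1 + η1 a1) / (1 - η2 a2)) * deriv (lagr η1 b1) (η1 a1) *
            (if a2 = b2 then (1:ℝ) else 0)
          + (if a1 = b1 then (1:ℝ) else 0) * deriv (lagr η2 b2) (η2 a2))
          * ev2 v (chi2 (η1 b1, η2 b2))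
        = ev2 (MvPolynomial.pderiv 1 v) (chi2 (η1 a1, η2 a2))) := by
  have hne : 1 - η2 a2 ≠ 0 := (sub_pos.mpr (hr2 a2).2).ne'
  set ξ := chi2 (η1 a1, η2 a2) with hξ
  have h1 : ∑ b1, deriv (lagr η1 b1) (η1 a1) * ev2 v (chi2 (η1 b1, η2 a2)) =
      (1 - η2 a2) / 2 * ev2 (MvPolynomial.pderiv 0 v) ξ := by
    have hline (t : ℝ) : chi2 (t, η2 a2) =
        ((1 - η2 a2) / 2 * t + ((1 - η2 a2) / 2 - 1), 0 * t + η2 a2) := by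
      ext <;> simp only [chi2] <;> ring
    simp only [hξ, hline]
    rw [sum_deriv_lagr_mul_ev2 hinj1 (hv.trans (min_le_left _ _)), zero_mul (ev2 _ _),
      add_zero (_ * _)]
  have h2 : ∑ b2, deriv (lagr η2 b2) (η2 a2) * ev2 v (chi2 (η1 a1, η2 b2)) =
      -((1 + η1 a1) / 2) * ev2 (MvPolynomial.pderiv 0 v) ξ +
        ev2 (MvPolynomial.pderiv 1 v) ξ := by
    have hline (t : ℝ) : chi2 (η1 a1, t) =
        (-((1 + η1 a1) / 2) * t + ((1 + η1 a1) / 2 - 1), 1 * t + 0) := by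
      ext <;> simp only [chi2] <;> ring
    simp only [hξ, hline]
    rw [sum_deriv_lagr_mul_ev2 hinj2 (hv.trans (min_le_right _ _)), one_mul (ev2 _ _)]
  have h3 (k : ℝ) : ∑ b1, ∑ b2, (k * deriv (lagr η1 b1) (η1 a1) *
      (if a2 = b2 then (1:ℝ) else 0)) * ev2 v (chi2 (η1 b1, η2 b2)) =
      k * ((1 - η2 a2) / 2 * ev2 (MvPolynomial.pderiv 0 v) ξ) := by
    simp [← h1, Finset.mul_sum, mul_assoc]
  refine ⟨?_, ?_⟩
  · rw [h3]
    field_simp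
  · simp only [add_mul _ _ (ev2 _ _), Finset.sum_add_distrib]
    rw [h3]
    have h4 : ∑ b1, ∑ b2, (if a1 = b1 then (1:ℝ) else 0) * deriv (lagr η2 b2) (η2 a2) *
        ev2 v (chi2 (η1 b1, η2 b2)) =
        ∑ b2, deriv (lagr η2 b2) (η2 a2) * ev2 v (chi2 (η1 a1, η2 b2)) := by
      rw [Finset.sum_comm]
      simp
    rw [h4, h2]
    field_simp
    ring
end
end

section
/- Let q1, q2 ∈ ℕ, q = min(q1, q2), let {η1^{(i)}}_{i=0}^{q1} ⊂ [−1,1] and {η2^{(i)}}_{i=0}^{q2} ⊂ [−1,1) be distinct nodes with Lagrange bases ℓ1^{(i)}, ℓ2^{(i)}, and set ξ^{(β1,β2)} = χ(η1^{(β1)}, η2^{(β2)}). Let {η_f^{(i)}}_{i=0}^{q_f} ⊂ [−1,1]. Then for every bivariate polynomial v of total degree at most q and every i ∈ {0,…,q_f}: (1) ∑_{β1,β2} ℓ1^{(β1)}(η_f^{(i)}) ℓ2^{(β2)}(−1) v(ξ^{(β1,β2)}) = v(χ(η_f^{(i)}, −1)); (2) ∑_{β1,β2} ℓ1^{(β1)}(1)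 ℓ2^{(β2)}(η_f^{(i)}) v(ξ^{(β1,β2)}) = v(χ(1, η_f^{(i)})); (3) ∑_{β1,β2} ℓ1^{(β1)}(−1) ℓ2^{(β2)}(η_f^{(i)}) v(ξ^{(β1,β2)}) = v(χ(−1, η_f^{(i)})). That is, the extrapolation operators to the three facets of the reference triangle are exact for polynomials of total degree at most q. -/
noncomputable section

/-- Lagrange interpolation reproduces polynomials of degree less than the number of nodes. -/
theorem sum_lagr_mul_eval {n : ℕ} {η : Fin (n + 1) → ℝ} (hη : Function.Injective η)
    {f : Polynomial ℝ} (hf : f.natDegree ≤ n) (x : ℝ) :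
    ∑ i, lagr η i x * f.eval (η i) = f.eval x := by
  have hdeg : f.degree < (Finset.univ : Finset (Fin (n + 1))).card := by
    rw [Finset.card_univ, Fintype.card_fin]
    exact Polynomial.degree_le_natDegree.trans_lt (by exact_mod_cast Nat.lt_succ_of_le hf)
  conv_rhs => rw [Lagrange.eq_interpolate hη.injOn hdeg]
  rw [Lagrange.interpolate_apply, Polynomial.eval_finsetSum]
  refine Finset.sum_congr rfl fun i _ => ?_
  rw [Polynomial.eval_mul, Polynomial.eval_C, mul_comm, lagr, Lagrange.basis,
    Polynomial.eval_prod]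
  congr 1
  refine Finset.prod_congr rfl fun j _ => ?_
  simp only [Lagrange.basisDivisor, Polynomial.eval_mul, Polynomial.eval_C, Polynomial.eval_sub,
    Polynomial.eval_X]
  rw [div_eq_inv_mul]

/-- The restriction of a bivariate polynomial to a parametrized line is a univariate polynomial
whose degree is at most the total degree. -/
theorem exists_polynomial_eval_eq_ev2_line (v : MvPolynomial (Fin 2) ℝ) (a b c d : ℝ) :
    ∃ f : Polynomial ℝ, f.natDegree ≤ v.totalDegree ∧
      ∀ t, f.eval t = ev2 v (a * t + b, c * t + d) := by
  let g : Fin 2 → Polynomial ℝ :=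
    ![Polynomial.C a * Polynomial.X + Polynomial.C b,
      Polynomial.C c * Polynomial.X + Polynomial.C d]
  refine ⟨MvPolynomial.aeval g v, ?_, fun t => ?_⟩
  · have hg : ∀ i, (g i).natDegree ≤ 1 := by
      intro i
      fin_cases i <;> exact Polynomial.natDegree_linear_le
    simpa using MvPolynomial.aeval_natDegree_le v le_rfl g hg
  · have h := MvPolynomial.map_aeval g (Polynomial.evalRingHom t) v
    rw [Polynomial.coe_evalRingHom] at h
    rw [h, ev2, MvPolynomial.eval, show (Polynomial.evalRingHom t).comp (algebraMap ℝ _) =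
      RingHom.id ℝ by ext; simp]
    congr 2
    ext i
    fin_cases i <;> simp [g]

/-- Tensor-product interpolation in collapsed coordinates is exact for polynomials of total degree
less than the number of nodes in each direction. -/
theorem sum_lagr_mul_lagr_mul_ev2_chi2 {q1 q2 : ℕ}
    {η1 : Fin (q1 + 1) → ℝ} {η2 : Fin (q2 + 1) → ℝ}
    (hinj1 : Function.Injective η1) (hinj2 : Function.Injective η2)
    {v : MvPolynomial (Fin 2) ℝ} (hv : v.totalDegree ≤ min q1 q2) (x y : ℝ) :
    ∑ b1, ∑ b2, lagr η1 b1 x * lagr η2 b2 y * ev2 v (chi2 (η1 b1, η2 b2))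
      = ev2 v (chi2 (x, y)) := by
  have hy : ∀ s, ∑ b2, lagr η2 b2 y * ev2 v (chi2 (s, η2 b2)) = ev2 v (chi2 (s, y)) := by
    intro s
    obtain ⟨f, hf, hfe⟩ :=
      exists_polynomial_eval_eq_ev2_line v (-(1 + s) / 2) ((1 + s) / 2 - 1) 1 0
    have hchi : ∀ t, ev2 v (chi2 (s, t)) = f.eval t := by
      intro t
      rw [hfe, chi2]
      congr 2 <;> ring
    simp only [hchi]
    exact sum_lagr_mul_eval hinj2 (hf.trans (hv.trans (min_le_right _ _))) y
  have hx : ∑ b1, lagr η1 b1 x * ev2 v (chi2 (η1 b1, y)) = ev2 v (chi2 (x, y)) := by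
    obtain ⟨f, hf, hfe⟩ :=
      exists_polynomial_eval_eq_ev2_line v ((1 - y) / 2) ((1 - y) / 2 - 1) 0 y
    have hchi : ∀ t, ev2 v (chi2 (t, y)) = f.eval t := by
      intro t
      rw [hfe, chi2]
      congr 2 <;> ring
    simp only [hchi]
    exact sum_lagr_mul_eval hinj1 (hf.trans (hv.trans (min_le_left _ _))) x
  simp only [mul_assoc, ← Finset.mul_sum, hy, hx]

theorem extrapolation_operators_exact_triangle (q1 q2 qf : ℕ)
    (η1 : Fin (q1 + 1) → ℝ) (η2 : Fin (q2 + 1) → ℝ) (ηf : Fin (qf + 1) → ℝ)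
    (hinj1 : Function.Injective η1) (hinj2 : Function.Injective η2)
    (hr1 : ∀ i, η1 i ∈ Set.Icc (-1:ℝ) 1) (hr2 : ∀ i, η2 i ∈ Set.Ico (-1:ℝ) 1)
    (hrf : ∀ i, ηf i ∈ Set.Icc (-1:ℝ) 1)
    (v : MvPolynomial (Fin 2) ℝ) (hv : v.totalDegree ≤ min q1 q2)
    (i : Fin (qf + 1)) :
    (∑ b1 : Fin (q1 + 1), ∑ b2 : Fin (q2 + 1),
        lagr η1 b1 (ηf i) * lagr η2 b2 (-1) * ev2 v (chi2 (η1 b1, η2 b2))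
        = ev2 v (chi2 (ηf i, -1))) ∧
    (∑ b1 : Fin (q1 + 1), ∑ b2 : Fin (q2 + 1),
        lagr η1 b1 1 * lagr η2 b2 (ηf i) * ev2 v (chi2 (η1 b1, η2 b2))
        = ev2 v (chi2 (1, ηf i))) ∧
    (∑ b1 : Fin (q1 + 1), ∑ b2 : Fin (q2 + 1),
        lagr η1 b1 (-1) * lagr η2 b2 (ηf i) * ev2 v (chi2 (η1 b1, η2 b2))
        = ev2 v (chi2 (-1, ηf i))) := by
  exact ⟨sum_lagr_mul_lagr_mul_ev2_chi2 hinj1 hinj2 hv _ _,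
    sum_lagr_mul_lagr_mul_ev2_chi2 hinj1 hinj2 hv _ _,
    sum_lagr_mul_lagr_mul_ev2_chi2 hinj1 hinj2 hv _ _⟩
end
end

section
/- For every Lebesgue-integrable function v : T̂ → ℝ on the reference tetrahedron, the change of variables identity ∫_{T̂} v(ξ) dξ = ∫_{−1}^{1} ∫_{−1}^{1} ∫_{−1}^{1} v(χ(η1, η2, η3)) · ((1−η2)(1−η3)²)/8 dη1 dη2 dη3 holds, where the left-hand side is the integral with respect to three-dimensional Lebesgue measure. -/
noncomputable section

/-- The collapsed coordinate map from the cube onto the reference tetrahedron. -/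
def chi3 (η : ℝ × ℝ × ℝ) : ℝ × ℝ × ℝ :=
  ((1 + η.1) * (1 - η.2.1) * (1 - η.2.2) / 4 - 1,
   (1 + η.2.1) * (1 - η.2.2) / 2 - 1, η.2.2)

/-- Evaluation of a trivariate polynomial at a point of `ℝ × ℝ × ℝ`. -/
def ev3 (v : MvPolynomial (Fin 3) ℝ) (x : ℝ × ℝ × ℝ) : ℝ :=
  MvPolynomial.eval ![x.1, x.2.1, x.2.2] v

/-- The reference tetrahedron `T̂ = {ξ ∈ [−1,1]³ : ξ1 + ξ2 + ξ3 ≤ −1}`. -/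
def refTet : Set (ℝ × ℝ × ℝ) :=
  {ξ | ξ.1 ∈ Set.Icc (-1:ℝ) 1 ∧ ξ.2.1 ∈ Set.Icc (-1:ℝ) 1 ∧ ξ.2.2 ∈ Set.Icc (-1:ℝ) 1 ∧
    ξ.1 + ξ.2.1 + ξ.2.2 ≤ -1}

open MeasureTheory

lemma measurableSet_refTet : MeasurableSet refTet := by
  apply IsClosed.measurableSet
  have : refTet = ((fun ξ : ℝ × ℝ × ℝ => ξ.1) ⁻¹' Set.Icc (-1) 1) ∩
      (((fun ξ : ℝ × ℝ × ℝ => ξ.2.1) ⁻¹' Set.Icc (-1) 1) ∩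
      (((fun ξ : ℝ × ℝ × ℝ => ξ.2.2) ⁻¹' Set.Icc (-1) 1) ∩
      {ξ : ℝ × ℝ × ℝ | ξ.1 + ξ.2.1 + ξ.2.2 ≤ -1})) := rfl
  rw [this]
  refine (isClosed_Icc.preimage (by fun_prop)).inter <|
    (isClosed_Icc.preimage (by fun_prop)).inter <|
    (isClosed_Icc.preimage (by fun_prop)).inter (isClosed_le (by fun_prop) (by fun_prop))

/-- Fubini's theorem on three real variables, integrating the first variable first. -/
lemma integral_prod_prod_symm {f : ℝ × ℝ × ℝ → ℝ} (hf : Integrable f) :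
    ∫ ξ, f ξ = ∫ z, ∫ y, ∫ x, f (x, y, z) := by
  rw [Measure.volume_eq_prod] at hf ⊢
  rw [integral_prod_symm f hf]
  have h := hf.integral_prod_right
  rw [Measure.volume_eq_prod] at h ⊢
  exact integral_prod_symm _ h

/-- The integral over the reference tetrahedron as an iterated integral over its slices. -/
lemma setIntegral_refTet {v : ℝ × ℝ × ℝ → ℝ} (hv : IntegrableOn v refTet) :
    ∫ ξ in refTet, v ξ =
      ∫ z in Set.Icc (-1 : ℝ) 1, ∫ y in (-1)..(-z), ∫ x in (-1)..(-1 - y - z), v (x, y, z) := by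
  rw [← integral_indicator measurableSet_refTet,
    integral_prod_prod_symm (hv.integrable_indicator measurableSet_refTet),
    ← integral_indicator measurableSet_Icc]
  congr 1 with z
  by_cases hz : z ∈ Set.Icc (-1 : ℝ) 1
  · rw [Set.indicator_of_mem hz, intervalIntegral.integral_of_le (by linarith [hz.2]),
      ← integral_Icc_eq_integral_Ioc, ← integral_indicator measurableSet_Icc]
    congr 1 with y
    by_cases hy : y ∈ Set.Icc (-1 : ℝ) (-z)
    · rw [Set.indicator_of_mem hy, intervalIntegral.integral_of_le (by linarith [hy.2]),
        ← integral_Icc_eq_integral_Ioc, ← integral_indicator measurableSet_Icc]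
      congr 1 with x
      refine Set.indicator_eq_indicator ?_ rfl
      simp only [refTet, Set.mem_ofPred_eq, Set.mem_Icc] at *
      grind
    · rw [Set.indicator_of_notMem hy, ← integral_zero ℝ ℝ]
      congr 1 with x
      refine Set.indicator_of_notMem ?_ _
      simp only [refTet, Set.mem_ofPred_eq, Set.mem_Icc] at *
      grind
  · rw [Set.indicator_of_notMem hz, ← integral_zero ℝ ℝ]
    congr 1 with y
    rw [← integral_zero ℝ ℝ]
    congr 1 with x
    refine Set.indicator_of_notMem ?_ _
    simp only [refTet, Set.mem_ofPred_eq, Set.mem_Icc] at *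
    grind

theorem change_of_variables_tetrahedron (v : ℝ × ℝ × ℝ → ℝ)
    (hv : MeasureTheory.IntegrableOn v refTet) :
    ∫ ξ in refTet, v ξ =
      ∫ η3 in Set.Icc (-1:ℝ) 1, ∫ η2 in Set.Icc (-1:ℝ) 1, ∫ η1 in Set.Icc (-1:ℝ) 1,
        v (chi3 (η1, η2, η3)) * ((1 - η2) * (1 - η3) ^ 2 / 8) := by
  rw [setIntegral_refTet hv]
  simp only [integral_Icc_eq_integral_Ioc,
    ← intervalIntegral.integral_of_le (show (-1 : ℝ) ≤ 1 by norm_num)]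
  congr 1 with z
  have outer := intervalIntegral.smul_integral_comp_mul_add (a := -1) (b := 1)
    (fun y => ∫ x in (-1)..(-1 - y - z), v (x, y, z)) ((1 - z) / 2) ((1 - z) / 2 - 1)
  rw [show (1 - z) / 2 * (-1) + ((1 - z) / 2 - 1) = -1 by ring,
    show (1 - z) / 2 * 1 + ((1 - z) / 2 - 1) = -z by ring] at outer
  rw [← outer, ← intervalIntegral.integral_smul]
  congr 1 with y
  have inner := intervalIntegral.smul_integral_comp_mul_add (a := -1) (b := 1)
    (fun x => v (x, (1 - z) / 2 * y + ((1 - z) / 2 - 1), z))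
    ((1 - y) * (1 - z) / 4) ((1 - y) * (1 - z) / 4 - 1)
  rw [show (1 - y) * (1 - z) / 4 * (-1) + ((1 - y) * (1 - z) / 4 - 1) = -1 by ring,
    show (1 - y) * (1 - z) / 4 * 1 + ((1 - y) * (1 - z) / 4 - 1) =
      -1 - ((1 - z) / 2 * y + ((1 - z) / 2 - 1)) - z by ring] at inner
  rw [← inner, smul_smul, ← intervalIntegral.integral_smul]
  congr 1 with x
  have hchi : chi3 (x, y, z) = ((1 - y) * (1 - z) / 4 * x + ((1 - y) * (1 - z) / 4 - 1),
      (1 - z) / 2 * y + ((1 - z) / 2 - 1), z) := by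
    ext <;> simp only [chi3] <;> ring
  rw [hchi, smul_eq_mul]
  ring
end
end
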